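/- Under the Lemma 6 setup (see context), y − x equals 2 or 3, and y − x = 2 if and only if A₀ = B₀ (in which case x+1 = y−1). -/

import Mathlib

open Finset

/-- `s^{n,k} = (n(n+1)/2)/k`. -/
def magicConst (n k : ℕ) : ℕ := (n * (n + 1) / 2) / k

/-- `A` is a partition of `[n] = {1,…,n}` into `k` (indexed) parts. -/
def IsPartitionOn (n : ℕ) {k : ℕ} (A : Fin k → Finset ℕ) : Prop :=
  (∀ i j : Fin k, i ≠ j → Disjoint (A i) (A j)) ∧
    Finset.univ.biUnion A = Finset.Icc 1 n

/-- The partition `A` of `[n]` implements the sequence of sizes `p` (up to reindexing). -/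
def Implements (n : ℕ) {k : ℕ} (A : Fin k → Finset ℕ) (p : Fin k → ℕ) : Prop :=
  IsPartitionOn n A ∧ ∃ e : Equiv.Perm (Fin k), ∀ i, (A (e i)).card = p i

/-- Every part of the partition has sum `s^{n,k}`. -/
def Equitable (n : ℕ) {k : ℕ} (A : Fin k → Finset ℕ) : Prop :=
  ∀ i, (A i).sum id = magicConst n k

/-- `d(A) = Σ_i (S(A_i) − s^{n,k})²`. -/
def dVal (n : ℕ) {k : ℕ} (A : Fin k → Finset ℕ) : ℤ :=
  ∑ i : Fin k, ((((A i).sum id : ℕ) : ℤ) - (magicConst n k : ℤ)) ^ 2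

/-- A partition implementing `p` minimizing `d` among all partitions implementing `p`. -/
def MinimalPartition (n : ℕ) {k : ℕ} (A : Fin k → Finset ℕ) (p : Fin k → ℕ) : Prop :=
  Implements n A p ∧ ∀ B : Fin k → Finset ℕ, Implements n B p → dVal n A ≤ dVal n B

/-- Condition (★): `Σ_{i=1}^{P_j} (n−i+1) ≥ j·s^{n,k}` for all `j = 1,…,k`,
where `P_j = p_1 + ⋯ + p_j`. -/
def StarCond (n k : ℕ) (p : Fin k → ℕ) : Prop :=
  ∀ j : Fin k,
    ((j : ℕ) + 1) * magicConst n k ≤ ∑ i ∈ Finset.range (∑ t ∈ Finset.Iic j, p t), (n - i)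

/-- The width `ω(A)` of a partition: the minimum of `y − x` over pairs `x < y` with `x`
in a low set and `y` in a high set (`⊤` if there is no such pair). -/
noncomputable def width (n : ℕ) {k : ℕ} (A : Fin k → Finset ℕ) : ℕ∞ :=
  sInf { w : ℕ∞ | ∃ (x y : ℕ) (i j : Fin k), x ∈ A i ∧ y ∈ A j ∧ x < y ∧
    (A i).sum id < magicConst n k ∧ magicConst n k < (A j).sum id ∧ w = (y - x : ℕ) }

theorem sum_image_swap_of_mem_left {s : Finset ℕ} {a : ℕ} (ha : a ∈ s) (hb : a + 1 ∉ s) :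
    (s.image (Equiv.swap a (a + 1))).sum id = s.sum id + 1 := by
  rw [sum_image (Equiv.injective _).injOn, ← add_sum_erase _ _ ha, ← add_sum_erase s id ha]
  have h : ∑ u ∈ s.erase a, id (Equiv.swap a (a + 1) u) = ∑ u ∈ s.erase a, id u := by
    refine sum_congr rfl fun u hu => ?_
    rw [Equiv.swap_apply_of_ne_of_ne (ne_of_mem_erase hu)]
    rintro rfl
    exact hb (mem_of_mem_erase hu)
  rw [h, Equiv.swap_apply_left]
  simp only [id]
  omega

theorem sum_image_swap_of_mem_right {s : Finset ℕ} {a : ℕ} (ha : a ∉ s) (hb : a + 1 ∈ s) :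
    (s.image (Equiv.swap a (a + 1))).sum id + 1 = s.sum id := by
  rw [sum_image (Equiv.injective _).injOn, ← add_sum_erase _ _ hb, ← add_sum_erase s id hb]
  have h : ∑ u ∈ s.erase (a + 1), id (Equiv.swap a (a + 1) u) = ∑ u ∈ s.erase (a + 1), id u := by
    refine sum_congr rfl fun u hu => ?_
    rw [Equiv.swap_apply_of_ne_of_ne _ (ne_of_mem_erase hu)]
    rintro rfl
    exact ha (mem_of_mem_erase hu)
  rw [h, Equiv.swap_apply_right]
  simp only [id]
  omega

theorem image_swap_of_notMem {s : Finset ℕ} {a b : ℕ} (ha : a ∉ s) (hb : b ∉ s) :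
    s.image (Equiv.swap a b) = s := by
  conv_rhs => rw [← image_id (s := s)]
  refine image_congr fun u hu => ?_
  exact Equiv.swap_apply_of_ne_of_ne (fun h => ha (h ▸ hu)) (fun h => hb (h ▸ hu))

section Partition

variable {n k : ℕ} {A : Fin k → Finset ℕ}

theorem IsPartitionOn.eq_of_mem (hA : IsPartitionOn n A) {i j : Fin k} {a : ℕ}
    (hi : a ∈ A i) (hj : a ∈ A j) : i = j := by
  by_contra h
  exact disjoint_left.1 (hA.1 i j h) hi hj

theorem IsPartitionOn.mem_Icc (hA : IsPartitionOn n A) {i : Fin k} {a : ℕ}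
    (hi : a ∈ A i) : a ∈ Icc 1 n :=
  hA.2 ▸ mem_biUnion.2 ⟨i, mem_univ i, hi⟩

theorem IsPartitionOn.exists_mem (hA : IsPartitionOn n A) {a : ℕ} (ha : a ∈ Icc 1 n) :
    ∃ i, a ∈ A i := by
  rw [← hA.2] at ha
  simpa using ha

theorem Implements.image_swap {p : Fin k → ℕ} (hA : Implements n A p) {a b : ℕ}
    (ha : a ∈ Icc 1 n) (hb : b ∈ Icc 1 n) :
    Implements n (fun l => (A l).image (Equiv.swap a b)) p := by
  obtain ⟨⟨hdis, hun⟩, e, he⟩ := hA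
  refine ⟨⟨fun i j hij => ?_, ?_⟩, e, fun i => ?_⟩
  · exact (disjoint_image (Equiv.injective _)).2 (hdis i j hij)
  · rw [← biUnion_image, hun]
    refine eq_of_subset_of_card_le (fun u hu => ?_) ?_
    · obtain ⟨v, hv, rfl⟩ := mem_image.1 hu
      rw [Equiv.swap_apply_def]
      split_ifs <;> assumption
    · rw [card_image_of_injective _ (Equiv.injective _)]
  · rw [card_image_of_injective _ (Equiv.injective _), he]

/-- Exchanging consecutive numbers between two parts whose sums differ by one interchanges the
sums of these parts. -/
theorem IsPartitionOn.sum_image_swap (hA : IsPartitionOn n A) {i j : Fin k} {a : ℕ}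
    (hi : a ∈ A i) (hj : a + 1 ∈ A j) (hS : (A i).sum id + 1 = (A j).sum id) (l : Fin k) :
    ((A l).image (Equiv.swap a (a + 1))).sum id = (A (Equiv.swap i j l)).sum id := by
  have hij : i ≠ j := by
    rintro rfl
    omega
  by_cases hli : l = i
  · subst hli
    rw [sum_image_swap_of_mem_left hi (fun h => hij (hA.eq_of_mem h hj)),
      Equiv.swap_apply_left, hS]
  by_cases hlj : l = j
  · subst hlj
    have := sum_image_swap_of_mem_right (fun h => hij (hA.eq_of_mem hi h)) hj
    rw [Equiv.swap_apply_right]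
    omega
  rw [image_swap_of_notMem (fun h => hli (hA.eq_of_mem h hi)) (fun h => hlj (hA.eq_of_mem h hj)),
    Equiv.swap_apply_of_ne_of_ne hli hlj]

theorem MinimalPartition.image_swap {p : Fin k → ℕ} (hA : MinimalPartition n A p) {i j : Fin k}
    {a : ℕ} (hi : a ∈ A i) (hj : a + 1 ∈ A j) (hS : (A i).sum id + 1 = (A j).sum id) :
    MinimalPartition n (fun l => (A l).image (Equiv.swap a (a + 1))) p := by
  refine ⟨hA.1.image_swap (hA.1.1.mem_Icc hi) (hA.1.1.mem_Icc hj), fun B hB => ?_⟩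
  refine le_trans (le_of_eq ?_) (hA.2 B hB)
  unfold dVal
  simp only [hA.1.1.sum_image_swap hi hj hS]
  exact Equiv.sum_comp (Equiv.swap i j)
    fun l => ((((A l).sum id : ℕ) : ℤ) - (magicConst n k : ℤ)) ^ 2

theorem width_le {i j : Fin k} {u v : ℕ} (hu : u ∈ A i) (hv : v ∈ A j) (huv : u < v)
    (hi : (A i).sum id < magicConst n k) (hj : magicConst n k < (A j).sum id) :
    width n A ≤ ((v - u : ℕ) : ℕ∞) :=
  sInf_le ⟨u, v, i, j, hu, hv, huv, hi, hj, rfl⟩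

theorem le_sub_of_mem_low_neighbour {p : Fin k → ℕ} {w : ℕ} (hA : MinimalPartition n A p)
    (hw : ∀ B : Fin k → Finset ℕ, MinimalPartition n B p → (w : ℕ∞) ≤ width n B)
    {i j l : Fin k} (hi : (A i).sum id + 1 = magicConst n k)
    (hj : (A j).sum id = magicConst n k + 1) (hl : (A l).sum id = magicConst n k)
    {x z v : ℕ} (hx : x ∈ A i) (hx' : x + 1 ∈ A l) (hz : z ∈ A l) (hzx : z ≠ x + 1)
    (hv : v ∈ A j) (hzv : z < v) : w ≤ v - z := by
  have hS : (A i).sum id + 1 = (A l).sum id := by omega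
  have hne : ∀ {s t : Fin k}, (A s).sum id ≠ (A t).sum id → s ≠ t := by
    rintro s _ h rfl
    exact h rfl
  have hil : i ≠ l := hne (by omega)
  have hji : j ≠ i := hne (by omega)
  have hjl : j ≠ l := hne (by omega)
  have hP := hA.1.1
  have hsum := hP.sum_image_swap hx hx' hS
  have hfix : ∀ c : ℕ, c ≠ x → c ≠ x + 1 → ∀ {t}, c ∈ A t →
      c ∈ (A t).image (Equiv.swap x (x + 1)) := fun _ h1 h2 _ h =>
    mem_image.2 ⟨_, h, Equiv.swap_apply_of_ne_of_ne h1 h2⟩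
  have hz' := hfix z (fun h => hil (hP.eq_of_mem (h ▸ hx) hz)) hzx hz
  have hv' := hfix v (fun h => hji (hP.eq_of_mem hv (h ▸ hx)))
    (fun h => hjl (hP.eq_of_mem hv (h ▸ hx'))) hv
  have h := (hw _ (hA.image_swap hx hx' hS)).trans (width_le (A := fun t => (A t).image _) hz' hv'
    hzv (by rw [hsum, Equiv.swap_apply_right]; omega)
    (by rw [hsum, Equiv.swap_apply_of_ne_of_ne hji hjl]; omega))
  exact_mod_cast h

theorem le_sub_of_mem_high_neighbour {p : Fin k → ℕ} {w : ℕ} (hA : MinimalPartition n A p)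
    (hw : ∀ B : Fin k → Finset ℕ, MinimalPartition n B p → (w : ℕ∞) ≤ width n B)
    {i j l : Fin k} (hi : (A i).sum id + 1 = magicConst n k)
    (hj : (A j).sum id = magicConst n k + 1) (hl : (A l).sum id = magicConst n k)
    {u y z : ℕ} (hy : y ∈ A l) (hy' : y + 1 ∈ A j) (hz : z ∈ A l) (hzy : z ≠ y)
    (hu : u ∈ A i) (huz : u < z) : w ≤ z - u := by
  have hS : (A l).sum id + 1 = (A j).sum id := by omega
  have hne : ∀ {s t : Fin k}, (A s).sum id ≠ (A t).sum id → s ≠ t := by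
    rintro s _ h rfl
    exact h rfl
  have hil : i ≠ l := hne (by omega)
  have hij : i ≠ j := hne (by omega)
  have hjl : j ≠ l := hne (by omega)
  have hP := hA.1.1
  have hsum := hP.sum_image_swap hy hy' hS
  have hfix : ∀ c : ℕ, c ≠ y → c ≠ y + 1 → ∀ {t}, c ∈ A t →
      c ∈ (A t).image (Equiv.swap y (y + 1)) := fun _ h1 h2 _ h =>
    mem_image.2 ⟨_, h, Equiv.swap_apply_of_ne_of_ne h1 h2⟩
  have hz' := hfix z hzy (fun h => hjl (hP.eq_of_mem (h ▸ hy') hz)) hz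
  have hu' := hfix u (fun h => hil (hP.eq_of_mem hu (h ▸ hy)))
    (fun h => hij (hP.eq_of_mem hu (h ▸ hy'))) hu
  have h := (hw _ (hA.image_swap hy hy' hS)).trans (width_le (A := fun t => (A t).image _) hu' hz'
    huz (by rw [hsum, Equiv.swap_apply_of_ne_of_ne hil hij]; omega)
    (by rw [hsum, Equiv.swap_apply_left]; omega))
  exact_mod_cast h

end Partition

/-- Lemma 6(i). -/
theorem stmt_13 (n : ℕ) (hn : 0 < n) (hdvd : 4 ∣ n * (n + 1) / 2)
    (p : Fin 4 → ℕ) (hp : ∀ i, 0 < p i)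
    (X Y Z W : Finset ℕ)
    (hmin : MinimalPartition n ![X, Y, Z, W] p)
    (hminw : ∀ B : Fin 4 → Finset ℕ, MinimalPartition n B p →
      width n ![X, Y, Z, W] ≤ width n B)
    (hfin : width n ![X, Y, Z, W] ≠ ⊤)
    (hX : X.sum id + 1 = magicConst n 4)
    (hY : Y.sum id = magicConst n 4 + 1)
    (hZ : Z.sum id = magicConst n 4) (hW : W.sum id = magicConst n 4)
    (x y : ℕ) (hx : x ∈ X) (hy : y ∈ Y) (hxy : x < y)
    (hw : width n ![X, Y, Z, W] = ((y - x : ℕ) : ℕ∞))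
    (A₀ B₀ : Finset ℕ) (hA₀ : A₀ = Z ∨ A₀ = W) (hB₀ : B₀ = Z ∨ B₀ = W)
    (hxA : x + 1 ∈ A₀) (hyB : y - 1 ∈ B₀) :
    (y - x = 2 ∨ y - x = 3) ∧ (y - x = 2 ↔ A₀ = B₀) ∧ (A₀ = B₀ → x + 1 = y - 1) := by
  set A : Fin 4 → Finset ℕ := ![X, Y, Z, W] with hA
  have hP := hmin.1.1
  have hw' : ∀ B : Fin 4 → Finset ℕ, MinimalPartition n B p →
      ((y - x : ℕ) : ℕ∞) ≤ width n B := fun B hB => hw ▸ hminw B hB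
  have h0 : (A 0).sum id + 1 = magicConst n 4 := hX
  have h1 : (A 1).sum id = magicConst n 4 + 1 := hY
  replace hx : x ∈ A 0 := hx
  replace hy : y ∈ A 1 := hy
  have hidx : ∀ C : Finset ℕ, C = Z ∨ C = W →
      ∃ l, C = A l ∧ (A l).sum id = magicConst n 4 ∧ (l = 2 ∨ l = 3) := by
    rintro C (rfl | rfl)
    · exact ⟨2, rfl, hZ, .inl rfl⟩
    · exact ⟨3, rfl, hW, .inr rfl⟩
  obtain ⟨a, rfl, ha, ha'⟩ := hidx A₀ hA₀
  obtain ⟨b, rfl, hb, hb'⟩ := hidx B₀ hB₀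
  have hyB' : y - 1 + 1 ∈ A 1 := by rwa [Nat.sub_add_cancel (by omega)]
  have hne1 : x + 1 ≠ y := by
    rintro rfl
    have := hP.eq_of_mem hxA hy
    subst this
    omega
  have hlow : ∀ z ∈ A a, z ≠ x + 1 → z < y → y - x ≤ y - z := fun z hz hzx hzy =>
    le_sub_of_mem_low_neighbour hmin hw' h0 h1 ha hx hxA hz hzx hy hzy
  have hhigh : ∀ z ∈ A b, z ≠ y - 1 → x < z → y - x ≤ z - x := fun z hz hzy hxz =>
    le_sub_of_mem_high_neighbour hmin hw' h0 h1 hb hyB hyB' hz hzy hx hxz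
  have heq : A a = A b → x + 1 = y - 1 := by
    intro h
    by_contra hne
    have := hlow (y - 1) (h ▸ hyB) (Ne.symm hne) (by omega)
    omega
  have hcases : A a = A b ∨ y - x = 3 := by
    by_contra! hcon
    obtain ⟨hab, h3⟩ := hcon
    have hne2 : x + 1 ≠ y - 1 := fun h => hab (congrArg A (hP.eq_of_mem (h ▸ hxA) hyB))
    have hyn := mem_Icc.1 (hP.mem_Icc hy)
    obtain ⟨l, hl⟩ := hP.exists_mem (a := x + 2) (mem_Icc.2 ⟨by omega, by omega⟩)
    have hl0 : l ≠ 0 := by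
      rintro rfl
      have := (hw' A hmin).trans (width_le hl hy (by omega) (by omega) (by omega))
      have : y - x ≤ y - (x + 2) := by exact_mod_cast this
      omega
    have hl1 : l ≠ 1 := by
      rintro rfl
      have := (hw' A hmin).trans (width_le hx hl (by omega) (by omega) (by omega))
      have : y - x ≤ x + 2 - x := by exact_mod_cast this
      omega
    have hla : l ≠ a := by
      rintro rfl
      have := hlow _ hl (by omega) (by omega)
      omega
    have hlb : l ≠ b := by
      rintro rfl
      have := hhigh _ hl (by omega) (by omega)
      omega
    have hab' : a ≠ b := fun h => hab (congrArg A h)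
    have hfour : ∀ a b l : Fin 4, (a = 2 ∨ a = 3) → (b = 2 ∨ b = 3) → a ≠ b →
        l ≠ 0 → l ≠ 1 → l ≠ a → l = b := by decide
    exact hlb (hfour a b l ha' hb' hab' hl0 hl1 hla)
  refine ⟨?_, ⟨fun h => ?_, fun h => ?_⟩, heq⟩
  · rcases hcases with h | h
    · have := heq h
      omega
    · exact .inr h
  · exact hcases.resolve_right (by omega)
  · have := heq h
    omega
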